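/- Let (R,Λ,S) be a generalised Renner–Coxeter system with length function ℓ. Let r ∈ R, s ∈ S, t ∈ S. If ℓ(srt) = ℓ(r) and ℓ(sr) = ℓ(rt) ≠ ℓ(r), then sr = rt. -/

import Mathlib

noncomputable section

/-- A generalised Renner–Coxeter system on a monoid `R`: a Coxeter system `(Rˣ, S)` on the unit
group (indexed by `B`, with data `cm`, `cs`), a cross-section semilattice `Λ` of idempotents,
and type maps `lam = λ`, `lamStar = λ_⋆` satisfying axioms (ECS1)–(ECS6). -/
structure GRCSystem (B : Type*) (R : Type*) [Monoid R] where
  /-- The Coxeter matrix indexing the simple reflections `S`. -/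
  cm : CoxeterMatrix B
  /-- (ECS3): the unit group of `R` is a Coxeter group. -/
  cs : CoxeterSystem cm Rˣ
  /-- The cross-section lattice `Λ`. -/
  Λ : Set R
  /-- The type map `λ`, with `W(e) = W_{λ(e)}`. -/
  lam : R → Set B
  /-- The map `λ_⋆`, with `W_⋆(e) = W_{λ_⋆(e)}`. -/
  lamStar : R → Set B
  /-- (ECS1): idempotents commute, i.e. `E(R)` is a (lower) semilattice. -/
  idem_mul_comm : ∀ e f : R, IsIdempotentElem e → IsIdempotentElem f → e * f = f * e
  /-- (ECS1): `R` is unit regular (factorisable). -/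
  factor : ∀ r : R, ∃ (e : R) (g : Rˣ), IsIdempotentElem e ∧ r = e * (g : R)
  /-- (ECS2): elements of `Λ` are idempotent. -/
  lam_idem : ∀ e ∈ Λ, IsIdempotentElem e
  /-- (ECS2): `Λ` is a sub-semilattice of `E(R)`. -/
  lam_mul_mem : ∀ e ∈ Λ, ∀ f ∈ Λ, e * f ∈ Λ
  /-- (ECS2): `Λ` is a transversal of `E(R)` for the conjugation action of the unit group. -/
  transversal : ∀ e : R, IsIdempotentElem e →
    ∃! f : R, f ∈ Λ ∧ ∃ w : Rˣ, (w : R) * f * ((w⁻¹ : Rˣ) : R) = e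
  /-- (ECS4): comparable idempotents are simultaneously conjugate to a comparable pair in `Λ`. -/
  ecs4 : ∀ e₁ e₂ : R, IsIdempotentElem e₁ → IsIdempotentElem e₂ →
    e₁ * e₂ = e₁ → e₂ * e₁ = e₁ →
    ∃ (w : Rˣ) (f₁ f₂ : R), f₁ ∈ Λ ∧ f₂ ∈ Λ ∧ f₁ * f₂ = f₁ ∧ f₂ * f₁ = f₁ ∧
      (w : R) * f₁ * ((w⁻¹ : Rˣ) : R) = e₁ ∧ (w : R) * f₂ * ((w⁻¹ : Rˣ) : R) = e₂
  /-- (ECS5): `W(e)` is the standard parabolic subgroup on `λ(e)`. -/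
  mem_lam_iff : ∀ e ∈ Λ, ∀ w : Rˣ,
    ((w : R) * e = e * (w : R)) ↔ w ∈ Subgroup.closure (cs.simple '' lam e)
  /-- (ECS5): `W_⋆(e)` is the standard parabolic subgroup on `λ_⋆(e)`. -/
  mem_lamStar_iff : ∀ e ∈ Λ, ∀ w : Rˣ,
    ((w : R) * e = e ∧ e * (w : R) = e) ↔ w ∈ Subgroup.closure (cs.simple '' lamStar e)
  /-- (ECS6): the map `e ↦ λ^⋆(e)` is order preserving. -/
  ecs6 : ∀ e ∈ Λ, ∀ f ∈ Λ, e * f = e →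
    ∀ s : B, ((cs.simple s : R) * e = e * (cs.simple s : R) ∧ (cs.simple s : R) * e ≠ e) →
      ((cs.simple s : R) * f = f * (cs.simple s : R) ∧ (cs.simple s : R) * f ≠ f)

namespace GRCSystem

variable {B R : Type*} [Monoid R] (G : GRCSystem B R)

/-- The standard parabolic subgroup `W_I` of the unit group of `R`. -/
def parab (I : Set B) : Subgroup Rˣ := Subgroup.closure (G.cs.simple '' I)

/-- The set `λ^⋆(e) = {s ∈ S : s e = e s ≠ e}`. -/
def lamCostar (e : R) : Set B :=
  {s : B | (G.cs.simple s : R) * e = e * (G.cs.simple s : R) ∧ (G.cs.simple s : R) * e ≠ e}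

/-- Value in `R` of a letter of the alphabet `S ⊔ R`. -/
def letterVal : B ⊕ R → R := Sum.elim (fun s => ((G.cs.simple s : Rˣ) : R)) id

/-- A word on the alphabet `S ∪ (Λ ∖ {1})`: every `inr` letter is a nonidentity element of `Λ`. -/
def IsWord (l : List (B ⊕ R)) : Prop := ∀ e : R, Sum.inr e ∈ l → e ∈ G.Λ ∧ e ≠ 1

/-- The length of a word: letters from `S` count 1, letters from `Λ` count 0. -/
def wordLen (l : List (B ⊕ R)) : ℕ := (l.filter Sum.isLeft).length

/-- The length `ℓ(r)`: the minimal length of a word on `S ∪ (Λ ∖ {1})` representing `r`. -/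
def len (r : R) : ℕ :=
  sInf {n : ℕ | ∃ l : List (B ⊕ R), G.IsWord l ∧ (l.map G.letterVal).prod = r ∧ n = wordLen l}

/-- `(w₁, e, w₂)` is the normal decomposition of `r`: `e ∈ Λ`, `w₁` is `(∅, λ_⋆(e))`-reduced
(minimal length in `w₁ W_{λ_⋆(e)}`), `w₂` is `(λ(e), ∅)`-reduced (minimal length in
`W_{λ(e)} w₂`), and `r = w₁ e w₂`. -/
def IsNormalDecomp (r : R) (w₁ : Rˣ) (e : R) (w₂ : Rˣ) : Prop :=
  e ∈ G.Λ ∧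
  (∀ u ∈ G.parab (G.lamStar e), G.cs.length w₁ ≤ G.cs.length (w₁ * u)) ∧
  (∀ u ∈ G.parab (G.lam e), G.cs.length w₂ ≤ G.cs.length (u * w₂)) ∧
  r = (w₁ : R) * e * (w₂ : R)

/-- `w` is `(I,J)`-reduced: `w` has minimal length in the double coset `W_I w W_J`. -/
def IsRed (I J : Set B) (w : Rˣ) : Prop :=
  ∀ u ∈ G.parab I, ∀ v ∈ G.parab J, G.cs.length w ≤ G.cs.length (u * w * v)

end GRCSystem

namespace CoxeterSystem

variable {B W : Type*} [Group W] {M : CoxeterMatrix B} (cs : CoxeterSystem M W)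

open Classical in
/-- The action of a simple reflection on `W × ZMod 2` that conjugates the first coordinate and
records in the second one whether the first coordinate is that simple reflection. -/
def signFun (i : B) : Function.End (W × ZMod 2) := fun p =>
  (cs.simple i * p.1 * cs.simple i, p.2 + if p.1 = cs.simple i then 1 else 0)

theorem simple_mul_simple_pow_mul_simple (i j : B) (k : ℕ) :
    (cs.simple j * cs.simple i) ^ k * cs.simple j =
      cs.simple j * (cs.simple i * cs.simple j) ^ k := by
  induction k with
  | zero => simp
  | succ k ih => rw [pow_succ', mul_assoc, ih, pow_succ']; simp only [mul_assoc]

theorem _root_.Function.End.mul_apply {α : Type*} (f g : Function.End α) (x : α) :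
    (f * g) x = f (g x) := rfl

open Classical in
theorem signFun_mul_pow_apply (i j : B) (n : ℕ) (t : W) (z : ZMod 2) :
    ((cs.signFun i * cs.signFun j) ^ n) (t, z) =
      ((cs.simple i * cs.simple j) ^ n * t * (cs.simple j * cs.simple i) ^ n,
        z + ∑ k ∈ Finset.range (2 * n),
          if t = (cs.simple j * cs.simple i) ^ k * cs.simple j then 1 else 0) := by
  induction n with
  | zero => simp [Function.End.one_def]
  | succ n ih =>
    have hcomm := cs.simple_mul_simple_pow_mul_simple i j n
    have hinv : cs.simple i * cs.simple j = (cs.simple j * cs.simple i)⁻¹ := by simp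
    rw [hinv, inv_pow] at hcomm
    have key (x y : W) :
        (cs.simple i * cs.simple j) ^ n * x * (cs.simple j * cs.simple i) ^ n = y ↔
        x = (cs.simple j * cs.simple i) ^ n * y * ((cs.simple j * cs.simple i) ^ n)⁻¹ := by
      rw [hinv, inv_pow]
      constructor
      · rintro rfl; group
      · rintro rfl; group
    have hfst : (cs.simple i * cs.simple j) ^ n * t * (cs.simple j * cs.simple i) ^ n =
        cs.simple j ↔ t = (cs.simple j * cs.simple i) ^ (2 * n) * cs.simple j := by
      rw [key, mul_assoc, ← hcomm, two_mul, pow_add, mul_assoc]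
    have hsnd : cs.simple j * ((cs.simple i * cs.simple j) ^ n * t *
        (cs.simple j * cs.simple i) ^ n) * cs.simple j = cs.simple i ↔
        t = (cs.simple j * cs.simple i) ^ (2 * n + 1) * cs.simple j := by
      have hconj (x : W) : cs.simple j * x * cs.simple j = cs.simple i ↔
          x = cs.simple j * cs.simple i * cs.simple j := by
        constructor
        · intro h; rw [← h]; simp [mul_assoc]
        · rintro rfl; simp [mul_assoc]
      rw [hconj, key, mul_assoc, mul_assoc _ (cs.simple j) (_⁻¹), ← hcomm, ← mul_assoc,
        ← mul_assoc, ← pow_succ, ← pow_add, show n + 1 + n = 2 * n + 1 by ring]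
    rw [pow_succ' (cs.signFun i * cs.signFun j), Function.End.mul_apply, ih,
      Function.End.mul_apply]
    simp only [signFun, hfst, hsnd, mul_add, mul_one, Finset.sum_range_succ, Prod.mk.injEq]
    constructor
    · rw [pow_succ', pow_succ]
      simp only [mul_assoc]
    · simp only [add_assoc]

theorem signFun_isLiftable : M.IsLiftable cs.signFun := by
  classical
  intro i j
  funext ⟨t, z⟩
  rw [signFun_mul_pow_apply, two_mul, Finset.sum_range_add]
  simp [Function.End.one_def, pow_add, CharTwo.add_self_eq_zero]

/-- The action of the Coxeter group on `W × ZMod 2` generated by the maps `signFun`. -/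
def signHom : W →* Function.End (W × ZMod 2) := cs.lift ⟨cs.signFun, cs.signFun_isLiftable⟩

theorem signHom_simple (i : B) : cs.signHom (cs.simple i) = cs.signFun i :=
  cs.lift_apply_simple cs.signFun_isLiftable i

open Classical in
theorem signHom_wordProd_apply (ω : List B) (t : W) (z : ZMod 2) :
    cs.signHom (cs.wordProd ω) (t, z) =
      (cs.wordProd ω * t * (cs.wordProd ω)⁻¹, z + (cs.rightInvSeq ω).count t) := by
  induction ω with
  | nil => simp [Function.End.one_def]
  | cons i ω ih =>
    rw [wordProd_cons, map_mul, Function.End.mul_apply, ih, signHom_simple]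
    have : cs.wordProd ω * t * (cs.wordProd ω)⁻¹ = cs.simple i ↔
        (cs.wordProd ω)⁻¹ * cs.simple i * cs.wordProd ω = t := by
      constructor
      · intro h; rw [← h]; group
      · intro h; rw [← h]; group
    simp only [signFun, this, rightInvSeq, List.count_cons, beq_iff_eq]
    simp [mul_assoc, add_assoc]

/-- The exchange property. -/
theorem exists_mul_simple_eq_wordProd_eraseIdx (ω : List B) (i : B)
    (h : cs.length (cs.wordProd ω * cs.simple i) < cs.length (cs.wordProd ω)) :
    ∃ j < ω.length, cs.wordProd ω * cs.simple i = cs.wordProd (ω.eraseIdx j) := by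
  classical
  suffices hmem : cs.simple i ∈ cs.rightInvSeq ω by
    obtain ⟨j, hj, hji⟩ := List.mem_iff_getElem.mp hmem
    refine ⟨j, by simpa using hj, ?_⟩
    rw [← wordProd_mul_getD_rightInvSeq, List.getD_eq_getElem _ 1 hj, hji]
  by_contra hmem
  obtain ⟨ω', hω', hprod⟩ := cs.exists_isReduced (cs.wordProd ω * cs.simple i)
  have h1 := cs.signHom_wordProd_apply ω' (cs.simple i) 0
  rw [← hprod, map_mul, Function.End.mul_apply, signHom_simple, signFun,
    signHom_wordProd_apply] at h1
  simp only [simple_mul_simple_self, one_mul, List.count_eq_zero_of_not_mem hmem] at h1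
  have h2 : cs.simple i ∈ cs.rightInvSeq ω' := by
    by_contra hmem'
    rw [List.count_eq_zero_of_not_mem hmem'] at h1
    simpa using congrArg Prod.snd h1
  have h3 := (cs.isRightInversion_of_mem_rightInvSeq hω' h2).2
  rw [← hprod, simple_mul_simple_cancel_right] at h3
  omega

/-- The deletion property. -/
theorem exists_sublist_isReduced (ω : List B) :
    ∃ ω' : List B, ω'.Sublist ω ∧ cs.IsReduced ω' ∧ cs.wordProd ω' = cs.wordProd ω := by
  induction ω using List.reverseRecOn with
  | nil => exact ⟨[], .refl _, by simp [IsReduced], rfl⟩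
  | append_singleton ω i ih =>
    obtain ⟨ω', hsub, hred, hprod⟩ := ih
    have hred' := hred.eq
    rcases cs.length_mul_simple (cs.wordProd ω') i with h | h
    · refine ⟨ω' ++ [i], hsub.append (.refl _), ?_, by simp [wordProd_append, hprod]⟩
      simp [IsReduced, wordProd_append, h, hred']
    · obtain ⟨j, hj, hji⟩ := cs.exists_mul_simple_eq_wordProd_eraseIdx ω' i (by omega)
      refine ⟨ω'.eraseIdx j, ((List.eraseIdx_sublist ..).trans hsub).trans
        (List.sublist_append_left ..), ?_, by simp [wordProd_append, ← hji, hprod]⟩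
      have := List.length_eraseIdx_add_one hj
      rw [IsReduced, ← hji]
      omega

theorem simple_mul_eq_mul_simple {w : W} {i j : B}
    (h : cs.length (cs.simple i * w * cs.simple j) < cs.length (cs.simple i * w))
    (h' : cs.length w ≤ cs.length (w * cs.simple j)) :
    cs.simple i * w = w * cs.simple j := by
  obtain ⟨ω, hω, rfl⟩ := cs.exists_isReduced w
  rw [← wordProd_cons] at h
  obtain ⟨k, hk, hki⟩ := cs.exists_mul_simple_eq_wordProd_eraseIdx _ _ h
  rcases k with _ | k
  · rw [List.eraseIdx_cons_zero, wordProd_cons] at hki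
    rw [← mul_left_inj (cs.simple j), hki, simple_mul_simple_cancel_right]
  · rw [List.eraseIdx_cons_succ, wordProd_cons, wordProd_cons, mul_assoc, mul_right_inj] at hki
    rw [List.length_cons, Nat.add_lt_add_iff_right] at hk
    have h1 := List.length_eraseIdx_add_one hk
    have h2 := cs.length_wordProd_le (ω.eraseIdx k)
    have h3 := hω.eq
    rw [hki] at h'
    omega

section Parabolic

variable {cs} {I J : Set B}

theorem wordProd_mem_closure {ω : List B} (h : ∀ i ∈ ω, i ∈ I) :
    cs.wordProd ω ∈ Subgroup.closure (cs.simple '' I) := by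
  refine Subgroup.list_prod_mem _ fun x hx => ?_
  obtain ⟨i, hi, rfl⟩ := List.mem_map.mp hx
  exact Subgroup.subset_closure ⟨i, h i hi, rfl⟩

theorem exists_wordProd_of_mem_closure {w : W} (hw : w ∈ Subgroup.closure (cs.simple '' I)) :
    ∃ ω : List B, (∀ i ∈ ω, i ∈ I) ∧ cs.wordProd ω = w := by
  induction hw using Subgroup.closure_induction with
  | mem x hx =>
    obtain ⟨i, hi, rfl⟩ := hx
    exact ⟨[i], by simpa using hi, by simp⟩
  | one => exact ⟨[], by simp, by simp⟩
  | mul x y _ _ ihx ihy =>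
    obtain ⟨ω, hω, rfl⟩ := ihx
    obtain ⟨ω', hω', rfl⟩ := ihy
    refine ⟨ω ++ ω', fun i hi => ?_, by simp [wordProd_append]⟩
    exact (List.mem_append.mp hi).elim (hω i) (hω' i)
  | inv x _ ih =>
    obtain ⟨ω, hω, rfl⟩ := ih
    exact ⟨ω.reverse, by simpa using hω, by simp⟩

theorem simple_mem_closure_of_length_lt {w : W} {i : B}
    (hw : w ∈ Subgroup.closure (cs.simple '' I))
    (h : cs.length (w * cs.simple i) < cs.length w) :
    cs.simple i ∈ Subgroup.closure (cs.simple '' I) := by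
  obtain ⟨ω, hω, rfl⟩ := exists_wordProd_of_mem_closure hw
  obtain ⟨j, -, hj⟩ := cs.exists_mul_simple_eq_wordProd_eraseIdx ω i h
  rw [← Subgroup.mul_mem_cancel_left _ hw, hj]
  exact wordProd_mem_closure fun k hk => hω k (List.mem_of_mem_eraseIdx hk)

theorem IsReduced.simple_mem_closure {ω : List B} (hω : cs.IsReduced ω)
    (h : cs.wordProd ω ∈ Subgroup.closure (cs.simple '' I)) :
    ∀ i ∈ ω, cs.simple i ∈ Subgroup.closure (cs.simple '' I) := by
  induction ω using List.reverseRecOn with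
  | nil => simp
  | append_singleton ω i ih =>
    have hred : cs.IsReduced ω := by simpa using hω.take ω.length
    have h1 := hω.eq
    have h2 := hred.eq
    have hi : cs.simple i ∈ Subgroup.closure (cs.simple '' I) := by
      refine simple_mem_closure_of_length_lt h ?_
      rw [h1]
      simp [wordProd_append, h2]
    rw [wordProd_append, wordProd_singleton, Subgroup.mul_mem_cancel_right _ hi] at h
    intro k hk
    rcases List.mem_append.mp hk with hk | hk
    · exact ih hred h k hk
    · rwa [List.mem_singleton.mp hk]

theorem mem_closure_of_length_mul_eq {x y : W}
    (h : x * y ∈ Subgroup.closure (cs.simple '' I))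
    (hl : cs.length (x * y) = cs.length x + cs.length y) :
    y ∈ Subgroup.closure (cs.simple '' I) := by
  obtain ⟨ω, hω, rfl⟩ := cs.exists_isReduced x
  obtain ⟨ω', hω', rfl⟩ := cs.exists_isReduced y
  rw [← wordProd_append] at h hl
  have hred : cs.IsReduced (ω ++ ω') := by
    rw [IsReduced, hl, hω.eq, hω'.eq, List.length_append]
  refine Subgroup.list_prod_mem _ fun x hx => ?_
  obtain ⟨i, hi, rfl⟩ := List.mem_map.mp hx
  exact hred.simple_mem_closure h i (List.mem_append_right _ hi)

/-- Every element of a double coset of standard parabolic subgroups factors length-additively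
through an element of minimal length. -/
theorem exists_length_add_of_minimal {w p q : W}
    (hw : ∀ x ∈ Subgroup.closure (cs.simple '' I), ∀ y ∈ Subgroup.closure (cs.simple '' J),
      cs.length w ≤ cs.length (x * w * y))
    (hp : p ∈ Subgroup.closure (cs.simple '' I)) (hq : q ∈ Subgroup.closure (cs.simple '' J)) :
    ∃ p' ∈ Subgroup.closure (cs.simple '' I), ∃ q' ∈ Subgroup.closure (cs.simple '' J),
      p * w * q = p' * w * q' ∧
        cs.length (p * w * q) = cs.length p' + cs.length w + cs.length q' := by
  obtain ⟨α, hα, rfl⟩ := exists_wordProd_of_mem_closure hp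
  obtain ⟨β, hβ, rfl⟩ := exists_wordProd_of_mem_closure hq
  obtain ⟨ω, hω, rfl⟩ := cs.exists_isReduced w
  obtain ⟨γ, hsub, hred, hprod⟩ := cs.exists_sublist_isReduced (α ++ ω ++ β)
  obtain ⟨γ', β', rfl, hγ', hβ'⟩ := List.sublist_append_iff.mp hsub
  obtain ⟨α', ω', rfl, hα', hω'⟩ := List.sublist_append_iff.mp hγ'
  have hα'' := wordProd_mem_closure (cs := cs) fun i hi => hα i (hα'.subset hi)
  have hβ'' := wordProd_mem_closure (cs := cs) fun i hi => hβ i (hβ'.subset hi)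
  have hr := hred.eq
  simp only [wordProd_append, List.length_append] at hprod hr
  have h1 := cs.length_wordProd_le α'
  have h2 := cs.length_wordProd_le β'
  have h3 := cs.length_wordProd_le ω'
  have hmin := hw _ (mul_mem (inv_mem hα'') hp) _ (mul_mem hq (inv_mem hβ''))
  have heq : (cs.wordProd α')⁻¹ * cs.wordProd α * cs.wordProd ω *
      (cs.wordProd β * (cs.wordProd β')⁻¹) = cs.wordProd ω' := by
    calc _ = (cs.wordProd α')⁻¹ * (cs.wordProd α * cs.wordProd ω * cs.wordProd β) *
          (cs.wordProd β')⁻¹ := by group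
      _ = _ := by rw [← hprod]; group
  rw [heq] at hmin
  have h4 := hω.eq
  obtain rfl := hω'.eq_of_length_le (by omega)
  refine ⟨_, hα'', _, hβ'', hprod.symm, ?_⟩
  have h5 := cs.length_mul_le (cs.wordProd α' * cs.wordProd ω') (cs.wordProd β')
  have h6 := cs.length_mul_le (cs.wordProd α') (cs.wordProd ω')
  rw [← hprod]
  omega

theorem exists_length_add (w : W) :
    ∃ p ∈ Subgroup.closure (cs.simple '' I), ∃ w₀ : W, ∃ q ∈ Subgroup.closure (cs.simple '' J),
      (∀ x ∈ Subgroup.closure (cs.simple '' I), ∀ y ∈ Subgroup.closure (cs.simple '' J),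
        cs.length w₀ ≤ cs.length (x * w₀ * y)) ∧
      w = p * w₀ * q ∧ cs.length w = cs.length p + cs.length w₀ + cs.length q := by
  let S : Set ℕ := {n | ∃ x ∈ Subgroup.closure (cs.simple '' I),
    ∃ y ∈ Subgroup.closure (cs.simple '' J), cs.length (x * w * y) = n}
  have hS : S.Nonempty := ⟨_, 1, one_mem _, 1, one_mem _, rfl⟩
  obtain ⟨x, hx, y, hy, hxy⟩ := Nat.sInf_mem hS
  have hmin : ∀ a ∈ Subgroup.closure (cs.simple '' I), ∀ b ∈ Subgroup.closure (cs.simple '' J),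
      cs.length (x * w * y) ≤ cs.length (a * (x * w * y) * b) := by
    intro a ha b hb
    rw [hxy]
    exact Nat.sInf_le ⟨a * x, mul_mem ha hx, y * b, mul_mem hy hb, by simp only [mul_assoc]⟩
  have hw : x⁻¹ * (x * w * y) * y⁻¹ = w := by group
  obtain ⟨p, hp, q, hq, h, hl⟩ := exists_length_add_of_minimal hmin (inv_mem hx) (inv_mem hy)
  rw [hw] at h hl
  exact ⟨p, hp, x * w * y, q, hq, hmin, h, hl⟩

theorem length_mul_of_minimal {w p : W}
    (hw : ∀ x ∈ Subgroup.closure (cs.simple '' I), cs.length w ≤ cs.length (x * w))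
    (hp : p ∈ Subgroup.closure (cs.simple '' I)) :
    cs.length (p * w) = cs.length p + cs.length w := by
  obtain ⟨p', -, q, hq, h, hl⟩ := exists_length_add_of_minimal (cs := cs) (I := I) (J := ∅) (w := w)
    (fun x hx y hy => by
      obtain rfl : y = 1 := by simpa using hy
      simpa using hw x hx) hp (one_mem _)
  obtain rfl : q = 1 := by simpa using hq
  obtain rfl : p = p' := by simpa using h
  simpa using hl

/-- Deodhar's lemma. -/
theorem exists_mul_simple_eq_of_not_minimal {w : W} {i : B}
    (hw : ∀ x ∈ Subgroup.closure (cs.simple '' I), cs.length w ≤ cs.length (x * w))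
    (hi : cs.length w < cs.length (w * cs.simple i))
    (hn : ¬ ∀ x ∈ Subgroup.closure (cs.simple '' I),
      cs.length (w * cs.simple i) ≤ cs.length (x * (w * cs.simple i))) :
    ∃ k, cs.simple k ∈ Subgroup.closure (cs.simple '' I) ∧
      w * cs.simple i = cs.simple k * w := by
  push Not at hn
  obtain ⟨x, hx, hlt⟩ := hn
  have h1 := length_mul_of_minimal hw hx
  have h2 := cs.length_mul_simple w i
  have h3 := cs.length_mul_simple (x * w) i
  have h0 : cs.length x ≠ 0 := by
    intro h0
    rw [length_eq_zero_iff] at h0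
    simp [h0] at hlt
  rw [← mul_assoc] at hlt
  obtain ⟨k, rfl⟩ := cs.length_eq_one_iff.mp (show cs.length x = 1 by omega)
  exact ⟨k, hx, (cs.simple_mul_eq_mul_simple (by omega) hi.le).symm⟩

end Parabolic

end CoxeterSystem

namespace GRCSystem

variable {B R : Type*} [Monoid R] {G : GRCSystem B R}

theorem mem_parab_lam_iff {e : R} (he : e ∈ G.Λ) {w : Rˣ} :
    w ∈ G.parab (G.lam e) ↔ (w : R) * e = e * w :=
  (G.mem_lam_iff e he w).symm

theorem mem_parab_lamStar_iff {e : R} (he : e ∈ G.Λ) {w : Rˣ} :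
    w ∈ G.parab (G.lamStar e) ↔ (w : R) * e = e ∧ e * w = e :=
  (G.mem_lamStar_iff e he w).symm

theorem eq_of_conj_eq {e f : R} (he : e ∈ G.Λ) (hf : f ∈ G.Λ) {w : Rˣ}
    (h : (w : R) * e * ((w⁻¹ : Rˣ) : R) = f) : e = f :=
  (G.transversal f (G.lam_idem f hf)).unique ⟨he, w, h⟩ ⟨hf, 1, by simp⟩

theorem one_mem_Λ : (1 : R) ∈ G.Λ := by
  obtain ⟨f, ⟨hf, w, hw⟩, -⟩ := G.transversal 1 (by simp [IsIdempotentElem])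
  rw [Units.mul_inv_eq_iff_eq_mul, one_mul] at hw
  rwa [← w.isUnit.mul_left_cancel (hw.trans (mul_one _).symm)]

theorem _root_.IsIdempotentElem.units_conj {e : R} (he : IsIdempotentElem e) (w : Rˣ) :
    IsIdempotentElem ((w : R) * e * ((w⁻¹ : Rˣ) : R)) := by
  have : (w : R) * e * ((w⁻¹ : Rˣ) : R) * ((w : R) * e * ((w⁻¹ : Rˣ) : R)) =
      w * (e * e) * ((w⁻¹ : Rˣ) : R) := by simp [mul_assoc]
  rw [IsIdempotentElem, this, he.eq]

theorem exists_mul_mul (r : R) : ∃ (a : Rˣ) (e : R) (b : Rˣ), e ∈ G.Λ ∧ r = a * e * b := by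
  obtain ⟨f, g, hf, rfl⟩ := G.factor r
  obtain ⟨e, ⟨he, w, rfl⟩, -⟩ := G.transversal f hf
  exact ⟨w, e, w⁻¹ * g, he, by simp [mul_assoc]⟩

theorem mul_eq_of_mul_eq (G : GRCSystem B R) {e : R} (he : IsIdempotentElem e) {v : Rˣ}
    (h : e * (v : R) = e) :
    (v : R) * e = e := by
  have h' : e * ((v⁻¹ : Rˣ) : R) = e := by
    rw [Units.mul_inv_eq_iff_eq_mul, h]
  have h1 := G.idem_mul_comm e _ he (he.units_conj v⁻¹)
  rw [inv_inv] at h1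
  have h2 : e * (((v⁻¹ : Rˣ) : R) * e * v) = e := by
    rw [mul_assoc, h, ← mul_assoc, h', he.eq]
  rw [h2, mul_assoc _ e, h, mul_assoc, he.eq] at h1
  calc (v : R) * e = v * (((v⁻¹ : Rˣ) : R) * e) := by rw [← h1]
    _ = e := by simp

theorem eq_of_mul_mul_eq {a b a' b' : Rˣ} {e f : R} (he : e ∈ G.Λ) (hf : f ∈ G.Λ)
    (h : (a : R) * e * b = a' * f * b') :
    f = e ∧ ∃ u ∈ G.parab (G.lam e), ∃ v ∈ G.parab (G.lamStar e), a' = a * u ∧ b' = u⁻¹ * v * b := by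
  have hie := G.lam_idem e he
  have hif := G.lam_idem f hf
  have hx := hie.units_conj a
  have hy := hif.units_conj a'
  set x : R := a * e * ((a⁻¹ : Rˣ) : R) with hxd
  set y : R := a' * f * ((a'⁻¹ : Rˣ) : R) with hyd
  have hxy : x * ((a * b : Rˣ) : R) = y * ((a' * b' : Rˣ) : R) := by
    simp [hxd, hyd, mul_assoc] at h ⊢
    exact h
  have h1 : y * x = x := by
    rw [← (a * b).isUnit.mul_left_inj, mul_assoc, hxy, ← mul_assoc, hy.eq]
  have h2 : x * y = y := by
    rw [← (a' * b').isUnit.mul_left_inj, mul_assoc, ← hxy, ← mul_assoc, hx.eq]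
  have hxy' : x = y := by rw [← h1, ← G.idem_mul_comm x y hx hy, h2]
  obtain rfl : f = e := by
    refine (G.transversal x hx).unique ⟨hf, a', hxy'.symm⟩ ⟨he, a, rfl⟩
  have hu : ((a⁻¹ * a' : Rˣ) : R) * f = f * ((a⁻¹ * a' : Rˣ) : R) := by
    rw [hxd, hyd, Units.mul_inv_eq_iff_eq_mul] at hxy'
    rw [Units.val_mul, mul_assoc, Units.inv_mul_eq_iff_eq_mul, ← mul_assoc, hxy']
    simp [mul_assoc]
  refine ⟨rfl, a⁻¹ * a', (mem_parab_lam_iff he).mpr hu, a⁻¹ * a' * b' * b⁻¹, ?_, by group,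
    by group⟩
  have hv : f * ((a⁻¹ * a' * b' * b⁻¹ : Rˣ) : R) = f := by
    rw [mul_assoc (a⁻¹ * a'), Units.val_mul (a⁻¹ * a'), ← mul_assoc, ← hu, Units.val_mul,
      Units.val_mul, ← mul_assoc, Units.mul_inv_eq_iff_eq_mul]
    simp only [mul_assoc] at h ⊢
    rw [Units.inv_mul_eq_iff_eq_mul, h]
  exact (mem_parab_lamStar_iff he).mpr ⟨mul_eq_of_mul_eq G hie hv, hv⟩

theorem lamStar_conj_mem {e : R} (he : e ∈ G.Λ) {u v : Rˣ} (hu : u ∈ G.parab (G.lam e))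
    (hv : v ∈ G.parab (G.lamStar e)) : u * v * u⁻¹ ∈ G.parab (G.lamStar e) := by
  have hu' := (mem_parab_lam_iff he).mp (inv_mem hu)
  rw [mem_parab_lam_iff he] at hu
  rw [mem_parab_lamStar_iff he] at hv ⊢
  constructor
  · rw [Units.val_mul, Units.val_mul, mul_assoc, hu', mul_assoc, ← mul_assoc (v : R), hv.1,
      ← mul_assoc, hu]
    simp [mul_assoc]
  · rw [Units.val_mul, Units.val_mul, ← mul_assoc, ← mul_assoc, ← hu, mul_assoc (u : R), hv.2, hu]
    simp [mul_assoc]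

/-- An element of `W(g)` is a product of an element of `W(g)` lying in all `W(e)` for `e ∈ Λ`
above `g` and an element of `W_⋆(g)`. -/
theorem exists_eq_mul_of_mem_parab_lam {g : R} (hg : g ∈ G.Λ) {x : Rˣ}
    (hx : x ∈ G.parab (G.lam g)) :
    ∃ u ∈ G.parab (G.lam g), ∃ v ∈ G.parab (G.lamStar g), x = u * v ∧
      ∀ e ∈ G.Λ, g * e = g → u ∈ G.parab (G.lam e) := by
  rw [parab] at hx
  induction hx using Subgroup.closure_induction with
  | mem x hx =>
    have hx' : x ∈ G.parab (G.lam g) := Subgroup.subset_closure hx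
    obtain ⟨i, -, rfl⟩ := hx
    have hc := (mem_parab_lam_iff hg).mp hx'
    by_cases h : (G.cs.simple i : R) * g = g
    · exact ⟨1, one_mem _, _, (mem_parab_lamStar_iff hg).mpr ⟨h, hc ▸ h⟩, by simp,
        fun _ _ _ => one_mem _⟩
    · exact ⟨_, hx', 1, one_mem _, by simp, fun e he hge =>
        (mem_parab_lam_iff he).mpr (G.ecs6 g hg e he hge i ⟨hc, h⟩).1⟩
  | one => exact ⟨1, one_mem _, 1, one_mem _, by simp, fun _ _ _ => one_mem _⟩
  | mul x y _ _ ihx ihy =>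
    obtain ⟨u, hu, v, hv, rfl, h⟩ := ihx
    obtain ⟨u', hu', v', hv', rfl, h'⟩ := ihy
    refine ⟨u * u', mul_mem hu hu', u'⁻¹ * v * u'⁻¹⁻¹ * v',
      mul_mem (lamStar_conj_mem hg (inv_mem hu') hv) hv', by group,
      fun e he hge => mul_mem (h e he hge) (h' e he hge)⟩
  | inv x _ ih =>
    obtain ⟨u, hu, v, hv, rfl, h⟩ := ih
    exact ⟨u⁻¹, inv_mem hu, u * v⁻¹ * u⁻¹, lamStar_conj_mem hg hu (inv_mem hv), by group,
      fun e he hge => inv_mem (h e he hge)⟩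

theorem exists_mul_mul_eq_of_isRed {e f : R} (he : e ∈ G.Λ) (hf : f ∈ G.Λ) {w : Rˣ}
    (hw : G.IsRed (G.lam e) (G.lam f) w) : e * w * f ∈ G.Λ := by
  have hie := G.lam_idem e he
  have hif := G.lam_idem f hf
  have hk := hif.units_conj w
  set k : R := w * f * ((w⁻¹ : Rˣ) : R) with hkd
  have hek := G.idem_mul_comm e k hie hk
  set h : R := e * k with hhd
  have hh : IsIdempotentElem h := by
    rw [IsIdempotentElem, hhd, mul_assoc, ← mul_assoc k, ← hek, mul_assoc e, hk.eq, ← mul_assoc,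
      hie.eq]
  have hhe : h * e = h := by rw [hek, mul_assoc, hie.eq]
  have heh : e * h = h := by rw [hhd, ← mul_assoc, hie.eq]
  have hhk : h * k = h := by rw [hhd, mul_assoc, hk.eq]
  have hkh : k * h = h := by rw [hek, ← mul_assoc, hk.eq]
  obtain ⟨x, g, e', hg, he', hge, heg, hxg, hxe⟩ := G.ecs4 h e hh hie hhe heh
  obtain rfl := eq_of_conj_eq he' he hxe
  have hh' := hh.units_conj w⁻¹
  rw [inv_inv] at hh'
  set h' : R := ((w⁻¹ : Rˣ) : R) * h * w with hhd'
  have hh'f : h' * f = h' := by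
    have : f = ((w⁻¹ : Rˣ) : R) * k * w := by simp [hkd, mul_assoc]
    rw [this, hhd']
    calc _ = ((w⁻¹ : Rˣ) : R) * (h * k) * w := by simp [mul_assoc]
      _ = _ := by rw [hhk]
  have hfh' : f * h' = h' := by
    rw [G.idem_mul_comm f h' hif hh', hh'f]
  obtain ⟨y, g', f', hg', hf', hgf, hfg, hyg, hyf⟩ := G.ecs4 h' f hh' hif hh'f hfh'
  obtain rfl := eq_of_conj_eq hf' hf hyf
  obtain rfl : g' = g := by
    refine (G.transversal h hh).unique ⟨hg', w * y, ?_⟩ ⟨hg, x, hxg⟩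
    rw [mul_inv_rev, Units.val_mul, Units.val_mul]
    calc _ = (w : R) * (y * g' * ((y⁻¹ : Rˣ) : R)) * ((w⁻¹ : Rˣ) : R) := by simp [mul_assoc]
      _ = h := by rw [hyg, hhd']; simp [mul_assoc]
  rw [Units.mul_inv_eq_iff_eq_mul] at hxe hyf
  have hx : x ∈ G.parab (G.lam e') := (mem_parab_lam_iff he).mpr hxe
  have hy : y ∈ G.parab (G.lam f') := (mem_parab_lam_iff hf).mpr hyf
  have hz : x⁻¹ * w * y ∈ G.parab (G.lam g') := by
    rw [mem_parab_lam_iff hg]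
    rw [Units.mul_inv_eq_iff_eq_mul] at hxg hyg
    rw [Units.val_mul, Units.val_mul, mul_assoc, hyg, hhd', mul_assoc ((x⁻¹ : Rˣ) : R),
      Units.inv_mul_eq_iff_eq_mul]
    simp only [← mul_assoc]
    rw [hxg]
    simp [mul_assoc]
  obtain ⟨u, hu, v, hv, hzuv, hup⟩ := exists_eq_mul_of_mem_parab_lam hg hz
  have hp : u⁻¹ * x⁻¹ ∈ G.parab (G.lam e') := mul_mem (inv_mem (hup _ he hge)) (inv_mem hx)
  obtain ⟨p, -, q, -, hpq, hl⟩ := CoxeterSystem.exists_length_add_of_minimal hw hp hy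
  have hveq : v = u⁻¹ * x⁻¹ * w * y := by
    rw [mul_assoc u⁻¹, mul_assoc u⁻¹, hzuv, inv_mul_cancel_left]
  rw [← hveq] at hpq hl
  have h1 := G.cs.length_mul_le (p * w) q
  have h2 := G.cs.length_mul_le p w
  rw [← hpq] at h1
  have hv' := hv
  rw [hpq] at hv'
  have hq := CoxeterSystem.mem_closure_of_length_mul_eq hv' (by rw [← hpq]; omega)
  have hw' : w ∈ G.parab (G.lamStar g') :=
    CoxeterSystem.mem_closure_of_length_mul_eq ((Subgroup.mul_mem_cancel_right _ hq).mp hv')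
      (by omega)
  have hwi := (mem_parab_lamStar_iff hg).mp (inv_mem hw')
  rw [mem_parab_lamStar_iff hg] at hw'
  have hgh : g' * h = g' := by
    rw [hhd, hkd, ← mul_assoc, ← mul_assoc, ← mul_assoc, hge, hw'.2, hgf, hwi.2]
  have hhg : h * g' = g' := by
    rw [G.idem_mul_comm h g' hh (G.lam_idem g' hg), hgh]
  obtain ⟨z, f₁, f₂, hf₁, hf₂, hf₁₂, -, hz₁, hz₂⟩ := G.ecs4 g' h (G.lam_idem g' hg) hh hgh hhg
  obtain rfl := eq_of_conj_eq hf₁ hg hz₁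
  obtain rfl : f₂ = f₁ := (G.transversal h hh).unique ⟨hf₂, z, hz₂⟩ ⟨hf₁, x, hxg⟩
  have hmul : e' * w * f' = h * w := by
    rw [hhd, hkd]
    simp [mul_assoc]
  rw [hmul, ← hz₂, hz₁, hw'.2]
  exact hg

theorem exists_mul_mul_eq_and_length_le {e f : R} (he : e ∈ G.Λ) (hf : f ∈ G.Λ) (w : Rˣ) :
    ∃ (a : Rˣ) (g : R) (b : Rˣ), g ∈ G.Λ ∧ e * w * f = a * g * b ∧
      G.cs.length a + G.cs.length b ≤ G.cs.length w := by
  obtain ⟨a, ha, w₀, b, hb, hw₀, rfl, hl⟩ :=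
    CoxeterSystem.exists_length_add (cs := G.cs) (I := G.lam e) (J := G.lam f) w
  have ha' := (mem_parab_lam_iff he).mp ha
  have hb' := (mem_parab_lam_iff hf).mp hb
  refine ⟨a, e * w₀ * f, b, exists_mul_mul_eq_of_isRed he hf hw₀, ?_, by omega⟩
  calc e * ((a * w₀ * b : Rˣ) : R) * f = (e * a) * w₀ * (b * f) := by simp [mul_assoc]
    _ = a * (e * w₀ * f) * b := by rw [← ha', hb']; simp only [mul_assoc]

theorem exists_mul_mul_eq_prod (l : List (B ⊕ R)) (hl : G.IsWord l) :
    ∃ (a : Rˣ) (e : R) (b : Rˣ), e ∈ G.Λ ∧ (l.map G.letterVal).prod = a * e * b ∧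
      G.cs.length a + G.cs.length b ≤ wordLen l := by
  induction l with
  | nil => exact ⟨1, 1, 1, one_mem_Λ, by simp, by simp⟩
  | cons x l ih =>
    obtain ⟨a, e, b, he, hprod, hle⟩ := ih fun f hf => hl f (List.mem_cons_of_mem _ hf)
    rw [List.map_cons, List.prod_cons, hprod]
    rcases x with i | f
    · refine ⟨G.cs.simple i * a, e, b, he, by simp [letterVal, mul_assoc], ?_⟩
      have h1 := G.cs.length_mul_le (G.cs.simple i) a
      have h2 : wordLen (Sum.inl i :: l) = wordLen l + 1 := rfl
      rw [G.cs.length_simple] at h1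
      omega
    · obtain ⟨a', g, b', hg, heq, hle'⟩ :=
        exists_mul_mul_eq_and_length_le (hl f List.mem_cons_self).1 he a
      refine ⟨a', g, b' * b, hg, ?_, ?_⟩
      · rw [← mul_assoc, ← mul_assoc, Units.val_mul, ← mul_assoc, ← heq]
        rfl
      · have h1 := G.cs.length_mul_le b' b
        have h2 : wordLen (Sum.inr f :: l) = wordLen l := by simp [wordLen]
        omega

theorem prod_map_letterVal_inl (ω : List B) :
    ((ω.map Sum.inl).map G.letterVal).prod = (G.cs.wordProd ω : R) := by
  induction ω with
  | nil => simp
  | cons i ω ih =>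
    rw [List.map_cons, List.map_cons, List.prod_cons, ih, CoxeterSystem.wordProd_cons,
      Units.val_mul]
    rfl

theorem exists_isWord_wordLen_eq {e : R} (he : e ∈ G.Λ) (a b : Rˣ) :
    ∃ l : List (B ⊕ R), G.IsWord l ∧ (l.map G.letterVal).prod = a * e * b ∧
      G.cs.length a + G.cs.length b = wordLen l := by
  obtain ⟨α, hα, rfl⟩ := G.cs.exists_isReduced a
  obtain ⟨β, hβ, rfl⟩ := G.cs.exists_isReduced b
  have hmap (ω : List B) : wordLen (ω.map (Sum.inl : B → B ⊕ R)) = ω.length := by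
    rw [wordLen, List.filter_eq_self.mpr (by simp), List.length_map]
  have happ (l l' : List (B ⊕ R)) : wordLen (l ++ l') = wordLen l + wordLen l' := by
    simp [wordLen]
  rw [hα.eq, hβ.eq]
  by_cases h : e = 1
  · refine ⟨α.map Sum.inl ++ β.map Sum.inl, fun f hf => by simp at hf, ?_, ?_⟩
    · rw [List.map_append, List.prod_append, prod_map_letterVal_inl, prod_map_letterVal_inl, h,
        mul_one]
    · rw [happ, hmap, hmap]
  · refine ⟨α.map Sum.inl ++ ([Sum.inr e] ++ β.map Sum.inl), fun f hf => ?_, ?_, ?_⟩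
    · obtain rfl : f = e := by simpa using hf
      exact ⟨he, h⟩
    · rw [List.map_append, List.prod_append, List.map_append, List.prod_append,
        prod_map_letterVal_inl, prod_map_letterVal_inl, mul_assoc]
      simp [letterVal]
    · rw [happ, happ, hmap, hmap]
      simp [wordLen]

theorem len_le {a b : Rˣ} {e : R} (he : e ∈ G.Λ) :
    G.len (a * e * b) ≤ G.cs.length a + G.cs.length b :=
  Nat.sInf_le (exists_isWord_wordLen_eq he a b)

theorem exists_eq_mul_mul_and_length_le (r : R) :
    ∃ (a : Rˣ) (e : R) (b : Rˣ), e ∈ G.Λ ∧ r = a * e * b ∧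
      G.cs.length a + G.cs.length b ≤ G.len r := by
  have hne : {n : ℕ | ∃ l : List (B ⊕ R), G.IsWord l ∧ (l.map G.letterVal).prod = r ∧
      n = wordLen l}.Nonempty := by
    obtain ⟨a, e, b, he, rfl⟩ := exists_mul_mul (G := G) r
    exact ⟨_, exists_isWord_wordLen_eq he a b⟩
  obtain ⟨l, hl, hprod, hlen⟩ := Nat.sInf_mem hne
  obtain ⟨a, e, b, he, heq, hle⟩ := exists_mul_mul_eq_prod l hl
  exact ⟨a, e, b, he, hprod ▸ heq, hle.trans hlen.ge⟩

/-- Every element has a normal decomposition, and its length is additive along it. -/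
theorem exists_isNormalDecomp (r : R) :
    ∃ (a : Rˣ) (e : R) (b : Rˣ), G.IsNormalDecomp r a e b ∧
      G.len r = G.cs.length a + G.cs.length b := by
  obtain ⟨a, e, b, he, rfl, hle⟩ := exists_eq_mul_mul_and_length_le (G := G) r
  obtain ⟨p, hp, b₀, q, hq, hb₀, rfl, hl⟩ :=
    CoxeterSystem.exists_length_add (cs := G.cs) (I := G.lam e) (J := ∅) b
  obtain rfl : q = 1 := by simpa using hq
  have hpe := (mem_parab_lam_iff he).mp hp
  have heq : (a : R) * e * ((p * b₀ * 1 : Rˣ) : R) = ((a * p : Rˣ) : R) * e * b₀ := by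
    rw [mul_one, Units.val_mul, Units.val_mul, mul_assoc, mul_assoc, mul_assoc, ← mul_assoc (p : R),
      hpe, mul_assoc]
  rw [heq] at hle ⊢
  have h1 := G.cs.length_mul_le a p
  have h2 := len_le (G := G) (a := a * p) (b := b₀) he
  refine ⟨a * p, e, b₀, ⟨he, fun v hv => ?_, fun u hu => by simpa using hb₀ u hu 1 (one_mem _),
    rfl⟩, by omega⟩
  have h3 := len_le (G := G) (a := a * p * v) (b := b₀) he
  rw [Units.val_mul _ v, mul_assoc _ (v : R), ((mem_parab_lamStar_iff he).mp hv).1] at h3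
  omega

theorem exists_length_add_length_le_len {a b : Rˣ} {e : R} (he : e ∈ G.Λ)
    (hb : ∀ u ∈ G.parab (G.lam e), G.cs.length b ≤ G.cs.length (u * b)) :
    ∃ v ∈ G.parab (G.lamStar e),
      G.cs.length (a * v) + G.cs.length b ≤ G.len (a * e * b) := by
  obtain ⟨a', f, b', hf, heq, hle⟩ := exists_eq_mul_mul_and_length_le (G := G) (a * e * b)
  obtain ⟨rfl, u, hu, v, hv, rfl, rfl⟩ := eq_of_mul_mul_eq he hf heq
  have hv' : v ∈ G.parab (G.lam f) := by
    have := (mem_parab_lamStar_iff he).mp hv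
    rw [mem_parab_lam_iff he, this.1, this.2]
  refine ⟨v, hv, ?_⟩
  have h1 := CoxeterSystem.length_mul_of_minimal hb (mul_mem (inv_mem hu) hv')
  have h2 := G.cs.length_mul_le (a * u) (u⁻¹ * v)
  rw [mul_assoc, mul_inv_cancel_left] at h2
  omega

theorem simple_mul_eq_mul_simple_of_len_lt {r : R} {s t : B}
    (h1 : G.len ((G.cs.simple s : R) * r * (G.cs.simple t : R)) = G.len r)
    (hs : G.len r < G.len ((G.cs.simple s : R) * r))
    (ht : G.len r < G.len (r * (G.cs.simple t : R))) :
    (G.cs.simple s : R) * r = r * (G.cs.simple t : R) := by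
  obtain ⟨a, e, b, ⟨he, ha, hb, rfl⟩, hlen⟩ := exists_isNormalDecomp (G := G) r
  have hsr : (G.cs.simple s : R) * (a * e * b) = ((G.cs.simple s * a : Rˣ) : R) * e * b := by
    simp [mul_assoc]
  have hrt : (a * e * b : R) * (G.cs.simple t : R) = a * e * ((b * G.cs.simple t : Rˣ) : R) := by
    simp [mul_assoc]
  rw [hsr, mul_assoc (_ * e), ← Units.val_mul] at h1
  rw [hsr, hrt]
  rw [hsr] at hs
  rw [hrt] at ht
  have hsa := G.cs.length_simple_mul a s
  have hsa' := hs.trans_le (len_le he)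
  have hbt := G.cs.length_mul_simple b t
  have hbt' := ht.trans_le (len_le he)
  have hsar : ∀ v ∈ G.parab (G.lamStar e),
      G.cs.length (G.cs.simple s * a) ≤ G.cs.length (G.cs.simple s * a * v) := by
    by_contra hn
    have hinv (v x : Rˣ) : G.cs.length (v * x⁻¹) = G.cs.length (x * v⁻¹) := by
      rw [← G.cs.length_inv, mul_inv_rev, inv_inv]
    obtain ⟨k, hk, hka⟩ := CoxeterSystem.exists_mul_simple_eq_of_not_minimal (cs := G.cs)
      (I := G.lamStar e) (w := a⁻¹) (i := s)
      (fun v hv => by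
        rw [hinv, G.cs.length_inv]
        exact ha _ (inv_mem hv))
      (by rw [G.cs.length_inv, ← G.cs.length_inv (_ * _)]; simp; omega)
      (fun h => hn fun v hv => by
        have := h _ (inv_mem hv)
        rw [← G.cs.length_inv, ← G.cs.length_inv (_ * (_ * _))] at this
        simpa using this)
    have hka' : G.cs.simple s * a = a * G.cs.simple k := by
      simpa using congrArg (·⁻¹) hka
    rw [hka', Units.val_mul, mul_assoc (a : R) (G.cs.simple k : R),
      ((mem_parab_lamStar_iff he).mp hk).1] at hs
    exact hs.false
  by_cases hbr : ∀ u ∈ G.parab (G.lam e),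
      G.cs.length (b * G.cs.simple t) ≤ G.cs.length (u * (b * G.cs.simple t))
  · obtain ⟨v, hv, hle⟩ := exists_length_add_length_le_len (a := G.cs.simple s * a) he hbr
    have := hsar v hv
    omega
  · obtain ⟨k, hk, hkb⟩ := CoxeterSystem.exists_mul_simple_eq_of_not_minimal hb (by omega) hbr
    have hke := (mem_parab_lam_iff he).mp hk
    have hmove (x : Rˣ) : (x : R) * e * ((b * G.cs.simple t : Rˣ) : R) =
        ((x * G.cs.simple k : Rˣ) : R) * e * b := by
      rw [hkb, Units.val_mul, Units.val_mul, mul_assoc, ← mul_assoc e, ← hke]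
      simp only [mul_assoc]
    rw [hmove] at h1 ht ⊢
    have hak := ht.trans_le (len_le he)
    obtain ⟨v, hv, hle⟩ := exists_length_add_length_le_len
      (a := G.cs.simple s * a * G.cs.simple k) he hb
    have hv' := lamStar_conj_mem he hk hv
    set v' := G.cs.simple k * v * (G.cs.simple k)⁻¹ with hvd
    have hvk : G.cs.simple s * a * G.cs.simple k * v =
        G.cs.simple s * a * v' * G.cs.simple k := by
      rw [hvd]
      group
    have hmin := CoxeterSystem.length_mul_of_minimal (cs := G.cs) (I := G.lamStar e)
      (w := (G.cs.simple s * a)⁻¹) (p := v'⁻¹)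
      (fun x hx => by
        rw [G.cs.length_inv, ← G.cs.length_inv (x * _), mul_inv_rev, inv_inv]
        exact hsar _ (inv_mem hx)) (inv_mem hv')
    rw [← mul_inv_rev, G.cs.length_inv, G.cs.length_inv, G.cs.length_inv] at hmin
    have h3 := G.cs.length_mul_simple (G.cs.simple s * a * v') k
    rw [hvk] at hle
    have hone : v' = 1 := by
      rw [← G.cs.length_eq_zero_iff]
      omega
    rw [hone, mul_one] at hle
    rw [G.cs.simple_mul_eq_mul_simple (w := a) (i := s) (j := k) (by omega) (by omega)]

end GRCSystem

/-- Matsumoto's lemma for generalised Renner monoids: if `ℓ(s r t) = ℓ(r)` and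
`ℓ(s r) = ℓ(r t) ≠ ℓ(r)`, then `s r = r t`. -/
theorem renner_matsumoto
    {B R : Type*} [Monoid R] (G : GRCSystem B R)
    (r : R) (s t : B)
    (h1 : G.len ((G.cs.simple s : R) * r * (G.cs.simple t : R)) = G.len r)
    (h2 : G.len ((G.cs.simple s : R) * r) = G.len (r * (G.cs.simple t : R)))
    (h3 : G.len ((G.cs.simple s : R) * r) ≠ G.len r) :
    (G.cs.simple s : R) * r = r * (G.cs.simple t : R) := by
  rcases lt_or_gt_of_ne h3 with h | h
  · have hss : (G.cs.simple s : R) * ((G.cs.simple s : R) * r) = r := by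
      rw [← mul_assoc, ← Units.val_mul, G.cs.simple_mul_simple_self, Units.val_one, one_mul]
    have key := GRCSystem.simple_mul_eq_mul_simple_of_len_lt (G := G)
      (r := (G.cs.simple s : R) * r) (s := s) (t := t) (by rw [hss, h2]) (by rwa [hss])
      (by rwa [h1])
    rw [hss] at key
    calc (G.cs.simple s : R) * r
        = (G.cs.simple s : R) * ((G.cs.simple s : R) * (r * (G.cs.simple t : R))) := by
          rw [← mul_assoc _ r, ← key]
      _ = r * (G.cs.simple t : R) := by
          rw [← mul_assoc, ← Units.val_mul, G.cs.simple_mul_simple_self, Units.val_one, one_mul]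
  · exact GRCSystem.simple_mul_eq_mul_simple_of_len_lt h1 h (h2 ▸ h)
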